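/- If a Social Welfare Function w : P̄^N → P̄ has a dictator at individual i and satisfies Unrestricted Domain (w(p) ≠ 𝐜 for every p ∈ P^N), then no profile p ∈ P^N is a quasi-Gödel sentence with respect to the i-th indicator Υ_i in the Self-Reference System (w, Ω_i): for every p ∈ P^N it is not the case that p ≤ ¬(Υ_i ∗ p). Consequently, (w, Ω_i) is not a quasi-Gödelian system with respect to Υ_i. -/

import Mathlib

/-- A weak order on `A`: a transitive and complete (total) binary relation. -/
structure WeakOrder (A : Type*) where
  rel : A → A → Prop
  trans : ∀ a b c, rel a b → rel b c → rel a c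
  total : ∀ a b, rel a b ∨ rel b a

namespace WeakOrder

/-- Strict preference: `a ≺ b` in `r`. -/
def strict {A : Type*} (r : WeakOrder A) (a b : A) : Prop := r.rel a b ∧ ¬ r.rel b a

/-- The reversed (converse) weak order. -/
def reverse {A : Type*} (r : WeakOrder A) : WeakOrder A :=
  ⟨fun a b => r.rel b a, fun a b c h1 h2 => r.trans c b a h2 h1, fun a b => r.total b a⟩

end WeakOrder

/-- The totally indifferent weak order `𝐢`. -/
def indiff (A : Type*) : WeakOrder A :=
  ⟨fun _ _ => True, fun _ _ _ _ _ => trivial, fun _ _ => Or.inl trivial⟩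

/-- The strictness ordering on weak orders: `r ≤ s` iff every strict
preference of `s` is a strict preference of `r`. -/
def strLE {A : Type*} (r s : WeakOrder A) : Prop :=
  ∀ a b, s.strict a b → r.strict a b

/-- `P̄ = P ∪ {𝐜}`, with `none` playing the role of the contradictory
preference cycle `𝐜` and `some r` the weak order `r`. -/
abbrev Pbar (A : Type*) := Option (WeakOrder A)

/-- The strictness ordering extended to `P̄`, with `𝐜 = none` as bottom. -/
def barLE {A : Type*} : Pbar A → Pbar A → Prop
  | none, _ => True
  | some _, none => False
  | some r, some s => strLE r s

/-- `t` is a greatest lower bound of `r` and `s` in `(P̄, ≤)`. -/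
def IsGLBbar {A : Type*} (r s t : Pbar A) : Prop :=
  barLE t r ∧ barLE t s ∧ ∀ u, barLE u r → barLE u s → barLE u t

/-- `t` is a least upper bound of `r` and `s` in `(P̄, ≤)`. -/
def IsLUBbar {A : Type*} (r s t : Pbar A) : Prop :=
  barLE r t ∧ barLE s t ∧ ∀ u, barLE r u → barLE s u → barLE t u

open Classical in
/-- `r ⊓ s`: the greatest lower bound of `r` and `s` in `(P̄, ≤)` (which always
exists; `𝐜` as a default value otherwise). -/
noncomputable def pinf {A : Type*} (r s : Pbar A) : Pbar A :=
  if h : ∃ t, IsGLBbar r s t then h.choose else none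

/-- `t` is a least upper bound of the weak orders `r` and `s` in the
strictness ordering on `P`. -/
def IsLUBw {A : Type*} (r s t : WeakOrder A) : Prop :=
  strLE r t ∧ strLE s t ∧ ∀ u, strLE r u → strLE s u → strLE t u

/-- `t` is a greatest lower bound of the weak orders `r` and `s` in the
strictness ordering on `P`. -/
def IsGLBw {A : Type*} (r s t : WeakOrder A) : Prop :=
  strLE t r ∧ strLE t s ∧ ∀ u, strLE u r → strLE u s → strLE u t

open Classical in
/-- `r ⊔ s`: the least upper bound of two weak orders in the strictness
ordering (which always exists; default value otherwise). -/
noncomputable def wsup {A : Type*} (r s : WeakOrder A) : WeakOrder A :=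
  if h : ∃ t, IsLUBw r s t then h.choose else indiff A

/-- The join `+ : P̄ × P̄ → P̄`: `r + s = r ⊔ s` when both are weak orders,
and `𝐢` otherwise. -/
noncomputable def pjoin {A : Type*} : Pbar A → Pbar A → Pbar A
  | some r, some s => some (wsup r s)
  | _, _ => some (indiff A)

open Classical in
/-- Negation on `P̄`: `¬𝐜 = 𝐢`, `¬𝐢 = 𝐜`, and otherwise the weak order with
all strict preferences reversed. -/
noncomputable def pneg {A : Type*} : Pbar A → Pbar A
  | none => some (indiff A)
  | some r => if r = indiff A then none else some r.reverse

/-- The inclusion `P^N ⊆ P̄^N` of profiles of weak orders. -/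
def coeP {A : Type*} {N : ℕ} (p : Fin N → WeakOrder A) : Fin N → Pbar A :=
  fun j => some (p j)

/-- `w` has a dictator at individual `i`. -/
def HasDictatorAt {A : Type*} {N : ℕ} (w : (Fin N → Pbar A) → Pbar A) (i : Fin N) : Prop :=
  ∀ p : Fin N → WeakOrder A,
    (w (coeP p) = none → p i = indiff A) ∧
    (p i ≠ indiff A → barLE (w (coeP p)) (some (p i)))

/-- The application function `Ω_i`. -/
noncomputable def Omega {A : Type*} {N : ℕ} (i : Fin N) (p : Fin N → Pbar A) (r : Pbar A) :
    Fin N → Pbar A :=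
  fun j => if j = i then pinf (p i) r else none

/-- The `i`-th indicator `Υ_i`: `𝐢` in coordinate `i` and `𝐜` elsewhere. -/
def indicator {A : Type*} {N : ℕ} (i : Fin N) : Fin N → Pbar A :=
  fun j => if j = i then some (indiff A) else none

/-- Coordinatewise negation on tuples. -/
noncomputable def negT {A : Type*} {N : ℕ} (p : Fin N → Pbar A) : Fin N → Pbar A :=
  fun j => pneg (p j)

/-- Coordinatewise extended strictness order on tuples. -/
def leT {A : Type*} {N : ℕ} (s t : Fin N → Pbar A) : Prop :=
  ∀ j, barLE (s j) (t j)

/-- `p ∗ q := Ω_i(p, w(q))` in the Self-Reference System `(w, Ω_i)`. -/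
noncomputable def starOmega {A : Type*} {N : ℕ} (w : (Fin N → Pbar A) → Pbar A) (i : Fin N)
    (p q : Fin N → Pbar A) : Fin N → Pbar A :=
  Omega i p (w q)

/-- Two tuples are consistent (`s ⋈ t`) iff `s_j ⊓ t_j ≠ 𝐜` in every coordinate. -/
def Consistent {A : Type*} {N : ℕ} (s t : Fin N → Pbar A) : Prop :=
  ∀ j, pinf (s j) (t j) ≠ none

/-- `(Υ, d)` satisfies quasi-consistency in `(w, Ω_i)`: `d ≤ ¬(Υ ∗ ¬d)`. -/
noncomputable def QuasiConsistent {A : Type*} {N : ℕ} (w : (Fin N → Pbar A) → Pbar A)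
    (i : Fin N) (Υ d : Fin N → Pbar A) : Prop :=
  leT d (negT (starOmega w i Υ (negT d)))

/-- `d` is a quasi-Gödel sentence w.r.t. `Υ` in `(w, Ω_i)`: `d ≤ ¬(Υ ∗ d)`. -/
noncomputable def QuasiGodelSentence {A : Type*} {N : ℕ} (w : (Fin N → Pbar A) → Pbar A)
    (i : Fin N) (Υ d : Fin N → Pbar A) : Prop :=
  leT d (negT (starOmega w i Υ d))

/-- `(Υ, d)` satisfies quasi-completeness in `(w, Ω_i)`:
`¬(Υ ∗ d)` and `¬(Υ ∗ ¬d)` are inconsistent. -/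
noncomputable def QuasiComplete {A : Type*} {N : ℕ} (w : (Fin N → Pbar A) → Pbar A)
    (i : Fin N) (Υ d : Fin N → Pbar A) : Prop :=
  ¬ Consistent (negT (starOmega w i Υ d)) (negT (starOmega w i Υ (negT d)))

/-- `(w, Ω_i)` is a quasi-Gödelian system with respect to `Υ`. -/
noncomputable def QuasiGodelian {A : Type*} {N : ℕ} (w : (Fin N → Pbar A) → Pbar A)
    (i : Fin N) (Υ : Fin N → Pbar A) : Prop :=
  ∃ d : Fin N → WeakOrder A,
    QuasiGodelSentence w i Υ (coeP d) ∧
    ¬ (QuasiConsistent w i Υ (coeP d) ∧ QuasiComplete w i Υ (coeP d))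

/-- `a ≺ b` in `x ∈ P̄` (`𝐜` is regarded as containing every strict preference). -/
def strictIn {A : Type*} (x : Pbar A) (a b : A) : Prop :=
  match x with
  | none => True
  | some r => r.strict a b

/-- Unanimity for an extended Social Welfare Function. -/
def Unanimity {A : Type*} {N : ℕ} (w : (Fin N → Pbar A) → Pbar A) : Prop :=
  ∀ (p : Fin N → WeakOrder A) (a b : A),
    (∀ j, (p j).strict a b) → strictIn (w (coeP p)) a b

/-- Independence of Irrelevant Alternatives for an extended Social Welfare Function. -/
def IIA {A : Type*} {N : ℕ} (w : (Fin N → Pbar A) → Pbar A) : Prop :=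
  ∀ (p q : Fin N → WeakOrder A) (a b : A),
    (∀ j, ((p j).strict a b ↔ (q j).strict a b) ∧ ((p j).strict b a ↔ (q j).strict b a)) →
    ((strictIn (w (coeP p)) a b ↔ strictIn (w (coeP q)) a b) ∧
     (strictIn (w (coeP p)) b a ↔ strictIn (w (coeP q)) b a))

namespace WeakOrder

theorem rel_iff_not_strict {A : Type*} (r : WeakOrder A) (a b : A) :
    r.rel a b ↔ ¬ r.strict b a := by
  have := r.total a b
  unfold strict
  tauto

theorem exists_strict_of_ne_indiff {A : Type*} {r : WeakOrder A} (h : r ≠ indiff A) :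
    ∃ a b, r.strict a b := by
  by_contra! hr
  apply h
  have hrel : r.rel = fun _ _ => True := by
    funext a b
    simpa using (r.rel_iff_not_strict a b).2 (hr b a)
  cases r
  cases hrel
  rfl

theorem not_strict_indiff {A : Type*} (a b : A) : ¬ (indiff A).strict a b :=
  fun h => h.2 trivial

end WeakOrder

theorem strLE_antisymm {A : Type*} {r s : WeakOrder A} (hrs : strLE r s) (hsr : strLE s r) :
    r = s := by
  have hrel : r.rel = s.rel := by
    funext a b
    rw [r.rel_iff_not_strict, s.rel_iff_not_strict]
    exact propext (not_congr ⟨hsr b a, hrs b a⟩)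
  cases r
  cases s
  cases hrel
  rfl

theorem barLE_refl {A : Type*} (x : Pbar A) : barLE x x := by
  cases x with
  | none => trivial
  | some r => exact fun _ _ h => h

theorem barLE_antisymm {A : Type*} {x y : Pbar A} (hxy : barLE x y) (hyx : barLE y x) :
    x = y := by
  cases x <;> cases y
  · rfl
  · exact hyx.elim
  · exact hxy.elim
  · exact congrArg some (strLE_antisymm hxy hyx)

theorem barLE_indiff {A : Type*} (x : Pbar A) : barLE x (some (indiff A)) := by
  cases x with
  | none => trivial
  | some r => exact fun a b h => (WeakOrder.not_strict_indiff a b h).elim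

theorem pinf_eq_of_isGLBbar {A : Type*} {r s t : Pbar A} (h : IsGLBbar r s t) :
    pinf r s = t := by
  have hex : ∃ t, IsGLBbar r s t := ⟨t, h⟩
  rw [pinf, dif_pos hex]
  obtain ⟨h₁, h₂, -⟩ := hex.choose_spec
  exact barLE_antisymm (h.2.2 _ h₁ h₂) (hex.choose_spec.2.2 _ h.1 h.2.1)

theorem pinf_indiff_left {A : Type*} (x : Pbar A) : pinf (some (indiff A)) x = x :=
  pinf_eq_of_isGLBbar ⟨barLE_indiff x, barLE_refl x, fun _ _ h => h⟩

theorem negT_starOmega_indicator_self {A : Type*} {N : ℕ} (w : (Fin N → Pbar A) → Pbar A)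
    (i : Fin N) (q : Fin N → Pbar A) :
    negT (starOmega w i (indicator i) q) i = pneg (w q) := by
  simp [negT, starOmega, Omega, indicator, pinf_indiff_left]

/-- If `w` has a dictator at `i` and satisfies Unrestricted
Domain (`w(p) ≠ 𝐜` for every `p ∈ P^N`), then no profile `p ∈ P^N` is a
quasi-Gödel sentence with respect to `Υ_i` in `(w, Ω_i)`; consequently
`(w, Ω_i)` is not a quasi-Gödelian system with respect to `Υ_i`. -/
theorem dictator_not_quasi_godelian {A : Type*} {N : ℕ}
    (w : (Fin N → Pbar A) → Pbar A) (i : Fin N)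
    (hd : HasDictatorAt w i)
    (hud : ∀ p : Fin N → WeakOrder A, w (coeP p) ≠ none) :
    (∀ p : Fin N → WeakOrder A, ¬ QuasiGodelSentence w i (indicator i) (coeP p)) ∧
    ¬ QuasiGodelian w i (indicator i) := by
  have key (p : Fin N → WeakOrder A) : ¬ QuasiGodelSentence w i (indicator i) (coeP p) := by
    intro hp
    have hi := hp i
    rw [negT_starOmega_indicator_self] at hi
    obtain ⟨r, hr⟩ := Option.ne_none_iff_exists'.1 (hud p)
    rw [hr] at hi
    by_cases hri : r = indiff A
    · simp [coeP, pneg, hri, barLE] at hi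
    · simp only [coeP, pneg, if_neg hri, barLE] at hi
      obtain ⟨a, b, hab⟩ := WeakOrder.exists_strict_of_ne_indiff hri
      have hba : (p i).strict b a := hi b a hab
      have hpi : p i ≠ indiff A := fun h => WeakOrder.not_strict_indiff b a (h ▸ hba)
      have hle := (hd p).2 hpi
      rw [hr] at hle
      exact hab.2 (hle b a hba).1
  exact ⟨key, fun ⟨d, hd, _⟩ => key d hd⟩
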